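/- Assume the Hermitian diagonalization setup: A, α are Hermitian n×n complex matrices; g : ℝ → (n×n complex matrices) is differentiable with g(t) unitary for every t; a : ℝ → (Fin n → ℝ) has each coordinate differentiable; and for all t ∈ ℝ, g(t)·(A + t·α)·g(t)ᴴ = diagonal(a(t)). Suppose moreover that [A,α] = i·(c·1 + w wᴴ) for some c ∈ ℝ and some nonzero w : Fin n → ℂ. Then for every t the values a_1(t),…,a_n(t) are pairwise distinct, and for each i the derivative a_i′ is differentiable with a_i″(t) = 2·Σ_{j ≠ i} c² / (a_i(t) − a_j(t))³. That is, the eigenvalue curve of A + tα solves the classical Calogero–Moser system. -/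

import Mathlib

open Matrix

/-- Entrywise derivative of a matrix curve. -/
def EntryDeriv {n : ℕ} (M : ℝ → Matrix (Fin n) (Fin n) ℂ) (M' : Matrix (Fin n) (Fin n) ℂ)
    (t : ℝ) : Prop :=
  ∀ i j, HasDerivAt (fun s => M s i j) (M' i j) t

theorem EntryDeriv.mul {n : ℕ} {M N : ℝ → Matrix (Fin n) (Fin n) ℂ}
    {M' N' : Matrix (Fin n) (Fin n) ℂ} {t : ℝ}
    (hM : EntryDeriv M M' t) (hN : EntryDeriv N N' t) :
    EntryDeriv (fun s => M s * N s) (M' * N t + M t * N') t := by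
  intro i j
  have h := HasDerivAt.fun_sum (u := Finset.univ)
    (fun k _ => (hM i k).mul (hN k j))
  simp only [Matrix.mul_apply, Matrix.add_apply, ← Finset.sum_add_distrib]
  exact h

theorem EntryDeriv.unique {n : ℕ} {M : ℝ → Matrix (Fin n) (Fin n) ℂ}
    {M' N' : Matrix (Fin n) (Fin n) ℂ} {t : ℝ}
    (hM : EntryDeriv M M' t) (hN : EntryDeriv M N' t) : M' = N' := by
  ext i j
  exact (hM i j).unique (hN i j)

theorem hasDerivAt_re {f : ℝ → ℂ} {f' : ℂ} {t : ℝ} (h : HasDerivAt f f' t) :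
    HasDerivAt (fun s => (f s).re) f'.re t :=
  Complex.reCLM.hasFDerivAt.comp_hasDerivAt t h

/-- **Section 5.7** (classical Calogero–Moser, after Kazhdan–Kostant–Sternberg): in the
Hermitian diagonalization setup, if the momentum `[A,α]` equals `i(c·1 + w wᴴ)` with
`w ≠ 0`, then the eigenvalues stay pairwise distinct for all times and satisfy the
classical Calogero–Moser equations `aᵢ'' = 2 Σ_{j≠i} c²/(aᵢ-aⱼ)³`. -/
theorem classical_calogero_moser_of_rank_one_momentum
    (n : ℕ) (A α : Matrix (Fin n) (Fin n) ℂ)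
    (hA : A.IsHermitian) (hα : α.IsHermitian)
    (g : ℝ → Matrix (Fin n) (Fin n) ℂ)
    (hg : ∀ i j, Differentiable ℝ (fun t => g t i j))
    (hgu : ∀ t : ℝ, g t * (g t)ᴴ = 1)
    (a : ℝ → Fin n → ℝ)
    (ha : ∀ i, Differentiable ℝ (fun t => a t i))
    (hdiag : ∀ t : ℝ, g t * (A + t • α) * (g t)ᴴ
        = Matrix.diagonal (fun i => (a t i : ℂ)))
    (c : ℝ) (w : Fin n → ℂ) (hw : w ≠ 0)
    (hmom : A * α - α * A
        = Complex.I • ((c : ℂ) • (1 : Matrix (Fin n) (Fin n) ℂ)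
            + Matrix.vecMulVec w (star w))) :
    (∀ t : ℝ, Function.Injective (a t))
      ∧ ∀ (i : Fin n) (t : ℝ), HasDerivAt (deriv fun s => a s i)
          (2 * ∑ j ∈ Finset.univ.erase i, c ^ 2 / (a t i - a t j) ^ 3) t := by
  classical
  have hug : ∀ t, (g t)ᴴ * g t = 1 := fun t => mul_eq_one_comm.mp (hgu t)
  set B : ℝ → Matrix (Fin n) (Fin n) ℂ := fun t => g t * α * (g t)ᴴ with hB
  set D : ℝ → Matrix (Fin n) (Fin n) ℂ :=
    fun t => Matrix.diagonal (fun i => (a t i : ℂ)) with hD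
  -- the commutator equation, in the moving frame
  have hcomm : ∀ t, D t * B t - B t * D t
      = Complex.I • ((c : ℂ) • (1 : Matrix (Fin n) (Fin n) ℂ)
            + Matrix.vecMulVec (g t *ᵥ w) (star (g t *ᵥ w))) := by
    intro t
    have h1 : D t * B t - B t * D t = g t * (A * α - α * A) * (g t)ᴴ := by
      have e1 : D t = g t * (A + t • α) * (g t)ᴴ := (hdiag t).symm
      rw [e1]
      have e2 : g t * (A + t • α) * (g t)ᴴ * B t
          = g t * ((A + t • α) * α) * (g t)ᴴ := by
        calc _ = g t * (A + t • α) * ((g t)ᴴ * g t) * α * (g t)ᴴ := by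
              simp only [hB, Matrix.mul_assoc]
          _ = _ := by rw [hug]; simp only [Matrix.mul_assoc, Matrix.one_mul]
      have e3 : B t * (g t * (A + t • α) * (g t)ᴴ)
          = g t * (α * (A + t • α)) * (g t)ᴴ := by
        calc _ = g t * α * ((g t)ᴴ * g t) * (A + t • α) * (g t)ᴴ := by
              simp only [hB, Matrix.mul_assoc]
          _ = _ := by rw [hug]; simp only [Matrix.mul_assoc, Matrix.one_mul]
      rw [e2, e3, ← Matrix.sub_mul, ← Matrix.mul_sub]
      congr 2
      simp only [Matrix.add_mul, Matrix.mul_add, Matrix.smul_mul, Matrix.mul_smul]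
      abel
    rw [h1, hmom, Matrix.mul_smul, Matrix.smul_mul, Matrix.mul_add, Matrix.add_mul,
      Matrix.mul_smul, Matrix.smul_mul, Matrix.mul_one, hgu, Matrix.mul_vecMulVec,
      Matrix.vecMulVec_mul, Matrix.star_mulVec]
  have hent : ∀ t i j, ((a t i : ℂ) - a t j) * B t i j
      = Complex.I * ((if i = j then (c : ℂ) else 0)
          + (g t *ᵥ w) i * star ((g t *ᵥ w) j)) := by
    intro t i j
    have h := congrFun (congrFun (hcomm t) i) j
    simp only [hD, Matrix.sub_apply, Matrix.diagonal_mul, Matrix.mul_diagonal,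
      Matrix.smul_apply, Matrix.add_apply, Matrix.one_apply, Matrix.vecMulVec_apply,
      smul_eq_mul, Pi.star_apply, mul_ite, mul_one, mul_zero] at h
    rw [← h]; ring
  have hv : ∀ t i, (g t *ᵥ w) i * star ((g t *ᵥ w) i) = -(c : ℂ) := by
    intro t i
    have h := hent t i i
    simp only [sub_self, zero_mul, if_true] at h
    have h2 := (mul_eq_zero.mp h.symm).resolve_left Complex.I_ne_zero
    linear_combination h2
  have hc : 0 < n → (c : ℂ) ≠ 0 := by
    intro _ hc0
    apply hw
    have h0 : g 0 *ᵥ w = 0 := by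
      ext i
      have h := hv 0 i
      rw [hc0, neg_zero] at h
      simpa using h
    calc w = ((g 0)ᴴ * g 0) *ᵥ w := by rw [hug, Matrix.one_mulVec]
      _ = 0 := by rw [← Matrix.mulVec_mulVec, h0, Matrix.mulVec_zero]
  have hinj : ∀ t, Function.Injective (a t) := by
    intro t i j hij
    by_contra hne
    have h := hent t i j
    rw [hij, sub_self, zero_mul, if_neg hne, zero_add] at h
    have h2 := (mul_eq_zero.mp h.symm).resolve_left Complex.I_ne_zero
    have hci := hc i.pos
    rcases mul_eq_zero.mp h2 with h3 | h3
    · have h4 := hv t i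
      rw [h3, zero_mul] at h4
      exact hci (by linear_combination h4)
    · have h4 := hv t j
      rw [h3, mul_zero] at h4
      exact hci (by linear_combination h4)
  have hprod : ∀ t i j, i ≠ j → ((a t i : ℂ) - a t j) ^ 2 * (B t i j * B t j i) = (c : ℂ) ^ 2 := by
    intro t i j hne
    have h1 := hent t i j
    have h2 := hent t j i
    rw [if_neg hne, zero_add] at h1
    rw [if_neg hne.symm, zero_add] at h2
    have h3 := hv t i
    have h4 := hv t j
    calc _ = -((((a t i : ℂ) - a t j) * B t i j) * (((a t j : ℂ) - a t i) * B t j i)) := by ring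
      _ = -(Complex.I ^ 2) * (((g t *ᵥ w) i * star ((g t *ᵥ w) i))
            * ((g t *ᵥ w) j * star ((g t *ᵥ w) j))) := by rw [h1, h2]; ring
      _ = _ := by rw [h3, h4, Complex.I_sq]; ring
  -- derivatives
  let g' : ℝ → Matrix (Fin n) (Fin n) ℂ := fun t => Matrix.of fun i j => deriv (fun s => g s i j) t
  have dg : ∀ t, EntryDeriv g (g' t) t := fun t i j => (hg i j t).hasDerivAt
  have dh : ∀ t, EntryDeriv (fun s => (g s)ᴴ) (g' t)ᴴ t := fun t i j => (dg t j i).star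
  have dconst : ∀ (M : Matrix (Fin n) (Fin n) ℂ) t, EntryDeriv (fun _ => M) 0 t :=
    fun M t i j => hasDerivAt_const t (M i j)
  have dX : ∀ t, EntryDeriv (fun s : ℝ => A + s • α) α t := by
    intro t i j
    have h := ((hasDerivAt_id t).smul_const (α i j)).const_add (A i j)
    simpa using h
  have dD : ∀ t, EntryDeriv D (Matrix.diagonal fun i => ((deriv (fun s => a s i) t : ℝ) : ℂ)) t := by
    intro t i j
    by_cases hij : i = j
    · subst hij
      simp only [hD, Matrix.diagonal_apply_eq]
      exact (ha i t).hasDerivAt.ofReal_comp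
    · simp only [hD, Matrix.diagonal_apply_ne _ hij]
      exact hasDerivAt_const t 0
  let K : ℝ → Matrix (Fin n) (Fin n) ℂ := fun t => g' t * (g t)ᴴ
  have hK : ∀ t, g t * (g' t)ᴴ = - K t := by
    intro t
    have h := (dg t).mul (dh t)
    simp only [hgu] at h
    have h2 := h.unique (dconst 1 t)
    exact eq_neg_of_add_eq_zero_right h2
  have hg' : ∀ t, g' t = K t * g t := by
    intro t
    simp only [K, Matrix.mul_assoc, hug, Matrix.mul_one]
  have hgs' : ∀ t, (g' t)ᴴ = - ((g t)ᴴ * K t) := by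
    intro t
    rw [← Matrix.mul_neg, ← hK, ← Matrix.mul_assoc, hug, Matrix.one_mul]
  have dB : ∀ t, EntryDeriv B (K t * B t - B t * K t) t := by
    intro t
    have h := ((dg t).mul (dconst α t)).mul (dh t)
    convert h using 1
    rw [hgs', hg']
    simp only [hB, Matrix.mul_zero, add_zero, Matrix.mul_neg, Matrix.mul_assoc, sub_eq_add_neg]
  have hDeq : ∀ t, (Matrix.diagonal fun i => ((deriv (fun s => a s i) t : ℝ) : ℂ))
      = K t * D t + B t - D t * K t := by
    intro t
    have h := ((dg t).mul (dX t)).mul (dh t)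
    simp only [hdiag] at h
    rw [(dD t).unique h, hgs', hg']
    simp only [hD, ← hdiag, hB]
    generalize A + t • α = X
    simp only [Matrix.add_mul, Matrix.mul_neg, Matrix.mul_assoc, sub_eq_add_neg]
  have hDent : ∀ t i j, (if i = j then ((deriv (fun s => a s i) t : ℝ) : ℂ) else 0)
      = K t i j * a t j + B t i j - a t i * K t i j := by
    intro t i j
    have h := congrFun (congrFun (hDeq t) i) j
    simpa only [hD, Matrix.sub_apply, Matrix.add_apply, Matrix.diagonal_mul,
      Matrix.mul_diagonal, Matrix.diagonal_apply] using h
  refine ⟨hinj, fun i t => ?_⟩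
  have hd1 : (deriv fun s => a s i) = fun s => (B s i i).re := by
    funext s
    have h := hDent s i i
    rw [if_pos rfl] at h
    have h2 : ((deriv (fun s => a s i) s : ℝ) : ℂ) = B s i i := by rw [h]; ring
    rw [← h2, Complex.ofReal_re]
  rw [hd1]
  have hder := hasDerivAt_re (dB t i i)
  convert hder using 1
  have hval : (K t * B t - B t * K t) i i
      = ((2 * ∑ j ∈ Finset.univ.erase i, c ^ 2 / (a t i - a t j) ^ 3 : ℝ) : ℂ) := by
    push_cast
    rw [Matrix.sub_apply, Matrix.mul_apply, Matrix.mul_apply, ← Finset.sum_sub_distrib,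
      ← Finset.add_sum_erase _ _ (Finset.mem_univ i), Finset.mul_sum]
    rw [mul_comm (K t i i), sub_self, zero_add]
    refine Finset.sum_congr rfl fun j hj => ?_
    have hne : i ≠ j := (Finset.ne_of_mem_erase hj).symm
    have hsub : (a t i : ℂ) - a t j ≠ 0 := by
      rw [sub_ne_zero]
      exact fun h => hne (hinj t (Complex.ofReal_injective h))
    have k1 := hDent t i j
    have k2 := hDent t j i
    rw [if_neg hne] at k1
    rw [if_neg hne.symm] at k2
    have hp := hprod t i j hne
    rw [mul_div_assoc', eq_div_iff (pow_ne_zero 3 hsub), ← hp]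
    linear_combination (((a t i : ℂ) - a t j) ^ 2) * (B t j i * k1 + B t i j * k2)
  rw [hval, Complex.ofReal_re]
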